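/- Sequential decoding correctness. Let V_{M'} ⪯ V_M be BPE vocabularies. For every byte string s, decode_{M→M'}(encode(s; M)) = encode(s; M'): applying demerge_M, demerge_{M−1}, ..., demerge_{M'+1} to the canonical V_M-encoding of s yields exactly the canonical V_{M'}-encoding of s. In particular, taking M' = 0, applying demerge_M, ..., demerge_1 to encode(s; M) recovers the character sequence of s. -/

import Mathlib

open scoped ENNReal

/-- A BPE vocabulary with `M` merge rules over alphabet `α` with end-of-string
symbol `eos`.  The `i`-th merged token (0-based) is `left i ++ right i`, where each
of `left i`, `right i` is either a single non-`eos` alphabet symbol or an earlier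
merged token.  Tokens of the vocabulary are pairwise distinct. -/
structure BPE (α : Type*) (eos : α) (M : ℕ) where
  left : ℕ → List α
  right : ℕ → List α
  left_ok : ∀ i < M, (∃ a : α, a ≠ eos ∧ left i = [a]) ∨ ∃ j < i, left i = left j ++ right j
  right_ok : ∀ i < M, (∃ a : α, a ≠ eos ∧ right i = [a]) ∨ ∃ j < i, right i = left j ++ right j
  distinct : ∀ i < M, ∀ j < M, left i ++ right i = left j ++ right j → i = j

variable {α : Type*} [DecidableEq α] {eos : α} {M : ℕ}

/-- One merge pass: scan left to right, replacing each leftmost non-overlapping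
adjacent pair `(l, r)` by the merged token `l ++ r`. -/
def mergeStep (l r : List α) : List (List α) → List (List α)
  | [] => []
  | [x] => [x]
  | x :: y :: rest =>
      if x = l ∧ y = r then (l ++ r) :: mergeStep l r rest
      else x :: mergeStep l r (y :: rest)

/-- One demerge pass: replace every occurrence of the token `l ++ r` by the pair `(l, r)`. -/
def demergeStep (l r : List α) (e : List (List α)) : List (List α) :=
  (e.map fun t => if t = l ++ r then [l, r] else [t]).flatten

/-- `merge_{i+1}` (0-based index `i`). -/
def BPE.mergeAt (B : BPE α eos M) (i : ℕ) (e : List (List α)) : List (List α) :=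
  mergeStep (B.left i) (B.right i) e

/-- `demerge_{i+1}` (0-based index `i`). -/
def BPE.demergeAt (B : BPE α eos M) (i : ℕ) (e : List (List α)) : List (List α) :=
  demergeStep (B.left i) (B.right i) e

/-- `B.encodeRel K n e` applies the merges with 0-based indices `K, K+1, …, K+n-1`
in order; this is the relative encoding `encode_{K → K+n}`. -/
def BPE.encodeRel (B : BPE α eos M) (K : ℕ) : ℕ → List (List α) → List (List α)
  | 0, e => e
  | n + 1, e => B.mergeAt (K + n) (B.encodeRel K n e)

/-- `B.decodeRel K n e` applies the demerges with 0-based indices `K+n-1, …, K+1, K`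
in order; this is the relative decoding `decode_{K+n → K}`. -/
def BPE.decodeRel (B : BPE α eos M) (K : ℕ) : ℕ → List (List α) → List (List α)
  | 0, e => e
  | n + 1, e => B.decodeRel K n (B.demergeAt (K + n) e)

/-- The canonical encoding `encode(s; N)` of a byte string `s` with the first `N` merges. -/
def BPE.encode (B : BPE α eos M) (N : ℕ) (s : List α) : List (List α) :=
  B.encodeRel 0 N (s.map fun a => [a])

/-- `decode`: concatenate the byte strings of the tokens. -/
def decodeBytes (e : List (List α)) : List α := e.flatten

/-- An encoding over `V_N` is valid (canonical) if re-encoding its decoded string gives it back. -/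
def BPE.Valid (B : BPE α eos M) (N : ℕ) (e : List (List α)) : Prop :=
  B.encode N (decodeBytes e) = e

/-- `t` is a token of the truncated vocabulary `V_N` (alphabet symbols and the first `N` merges). -/
def BPE.IsTok (B : BPE α eos M) (N : ℕ) (t : List α) : Prop :=
  (∃ a : α, t = [a]) ∨ ∃ i < N, t = B.left i ++ B.right i

/-- `e` is a token sequence over the truncated vocabulary `V_N`. -/
def BPE.IsEnc (B : BPE α eos M) (N : ℕ) (e : List (List α)) : Prop :=
  ∀ t ∈ e, B.IsTok N t

/-- `e` (over `V_M`) is a relative cover encoding of `e'` (over `V_{M'}`):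
(1) `e` is a prefix of the canonical `V_M`-encoding of some byte sequence terminating
with `eos`, and (2) writing `e = e₀ ++ [t]`, for some index `k < |e'|` the relative
decoding of `e₀` equals the first `k` tokens of `e'` and the remaining tokens
`e'.drop k` form a prefix of the relative decoding of the last token `t`. -/
def BPE.IsCover (B : BPE α eos M) (M' : ℕ) (e' e : List (List α)) : Prop :=
  (∃ x : List α, x.getLast? = some eos ∧ e <+: B.encode M x) ∧
  ∃ (e₀ : List (List α)) (t : List α), e = e₀ ++ [t] ∧
    ∃ k < e'.length,
      B.decodeRel M' (M - M') e₀ = e'.take k ∧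
      e'.drop k <+: B.decodeRel M' (M - M') [t]

/-- The set `cover_{M'→M}(e')` of all relative cover encodings of `e'`. -/
def BPE.cover (B : BPE α eos M) (M' : ℕ) (e' : List (List α)) : Set (List (List α)) :=
  {e | B.IsCover M' e' e}

/-- `P_μ(e; N)`: the probability, under the language model `μ` on byte sequences
terminating with `eos`, that the canonical `V_N`-encoding begins with `e`. -/
noncomputable def BPE.Pr (B : BPE α eos M) (N : ℕ)
    (μ : PMF {x : List α // x.getLast? = some eos}) (e : List (List α)) : ℝ≥0∞ :=
  μ.toOuterMeasure {x | e <+: B.encode N x.val}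


theorem demergeStep_cons (l r t : List α) (e : List (List α)) :
    demergeStep l r (t :: e) = (if t = l ++ r then [l, r] else [t]) ++ demergeStep l r e := by
  simp [demergeStep]

/-- Demerging undoes merging on sequences in which the merged token does not yet occur. -/
theorem demergeStep_mergeStep (l r : List α) (e : List (List α)) (h : l ++ r ∉ e) :
    demergeStep l r (mergeStep l r e) = e := by
  fun_induction mergeStep l r e with
  | case1 => rfl
  | case2 x =>
    have hx : x ≠ l ++ r := by rintro rfl; simp at h
    simp [demergeStep, hx]
  | case3 x y rest hxy ih =>
    obtain ⟨rfl, rfl⟩ := hxy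
    rw [demergeStep_cons, ih (by simp_all)]
    simp
  | case4 x y rest hxy ih =>
    have hx : x ≠ l ++ r := by rintro rfl; simp at h
    rw [demergeStep_cons, ih (fun h' => h (List.mem_cons_of_mem _ h'))]
    simp [hx]

theorem mem_mergeStep {l r t : List α} {e : List (List α)} (h : t ∈ mergeStep l r e) :
    t ∈ e ∨ t = l ++ r := by
  fun_induction mergeStep l r e <;> grind

theorem BPE.isEnc_encode (B : BPE α eos M) (N : ℕ) (s : List α) : B.IsEnc N (B.encode N s) := by
  induction N with
  | zero =>
    intro t ht
    obtain ⟨a, -, rfl⟩ := List.mem_map.1 ht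
    exact .inl ⟨a, rfl⟩
  | succ N ih =>
    intro t ht
    change t ∈ B.mergeAt (0 + N) (B.encode N s) at ht
    rw [Nat.zero_add] at ht
    rcases mem_mergeStep ht with h | rfl
    · exact (ih t h).imp_right fun ⟨i, hi, hti⟩ => ⟨i, hi.trans N.lt_succ_self, hti⟩
    · exact .inr ⟨N, N.lt_succ_self, rfl⟩

theorem BPE.left_ne_nil {α : Type*} {eos : α} {M : ℕ} (B : BPE α eos M) (i : ℕ) (hi : i < M) :
    B.left i ≠ [] := by
  induction i using Nat.strong_induction_on with
  | _ i ih =>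
    rcases B.left_ok i hi with ⟨a, -, h⟩ | ⟨j, hj, h⟩
    · simp [h]
    · simp [h, ih j hj (hj.trans hi)]

theorem BPE.right_ne_nil {α : Type*} {eos : α} {M : ℕ} (B : BPE α eos M) (i : ℕ) (hi : i < M) :
    B.right i ≠ [] := by
  rcases B.right_ok i hi with ⟨a, -, h⟩ | ⟨j, hj, h⟩
  · simp [h]
  · simp [h, B.left_ne_nil j (hj.trans hi)]

/-- The token created by a merge is not a token of the preceding vocabulary. -/
theorem BPE.not_isTok {α : Type*} {eos : α} {M : ℕ} (B : BPE α eos M) (N : ℕ) (hN : N < M) :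
    ¬ B.IsTok N (B.left N ++ B.right N) := by
  rintro (⟨a, h⟩ | ⟨i, hi, h⟩)
  · have hl := B.left_ne_nil N hN
    have hr := B.right_ne_nil N hN
    simp_all [List.append_eq_singleton_iff]
  · exact hi.ne (B.distinct N hN i (hi.trans hN) h).symm

theorem BPE.decodeRel_encode (B : BPE α eos M) (K n : ℕ) (h : K + n ≤ M) (s : List α) :
    B.decodeRel K n (B.encode (K + n) s) = B.encode K s := by
  induction n with
  | zero => rfl
  | succ n ih =>
    have key : B.demergeAt (K + n) (B.mergeAt (0 + (K + n)) (B.encode (K + n) s)) =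
        B.encode (K + n) s := by
      rw [Nat.zero_add]
      exact demergeStep_mergeStep _ _ _ fun hmem =>
        B.not_isTok (K + n) (by omega) (B.isEnc_encode _ _ _ hmem)
    change B.decodeRel K n (B.demergeAt (K + n) (B.mergeAt (0 + (K + n)) (B.encode (K + n) s))) = _
    rw [key, ih (by omega)]

/-- **Sequential decoding correctness.** For `V_{M'} ⪯ V_M` and every byte string `s`,
`decode_{M→M'}(encode(s; M)) = encode(s; M')`; in particular, for `M' = 0`, applying all
demerges to `encode(s; M)` recovers the character sequence of `s`. -/
theorem sequential_decoding_correct {α : Type*} [DecidableEq α] [Fintype α] {eos : α}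
    {M : ℕ} (B : BPE α eos M) (M' : ℕ) (hM : M' ≤ M) :
    (∀ s : List α, B.decodeRel M' (M - M') (B.encode M s) = B.encode M' s) ∧
    (∀ s : List α, B.decodeRel 0 M (B.encode M s) = s.map fun a => [a]) := by
  refine ⟨fun s => ?_, fun s => ?_⟩
  · simpa [Nat.add_sub_cancel' hM] using B.decodeRel_encode M' (M - M') (by omega) s
  · simpa [BPE.encode, BPE.encodeRel] using B.decodeRel_encode 0 M (by omega) s
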